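/- arXiv:2401.15837 — 2 statements merged into one kernel-verified Lean document; each statement's English description precedes it below -/
import Mathlib

section
/- Suppose K is closed at infinity, f(x) > 0 for all x ∈ K, and f is positive at infinity on K (f^(∞)(x) > 0 for all x ∈ K^(∞)). Let x(1),…,x(p) be subsets of {x_1,…,x_n} with union {x_1,…,x_n} and such that f = f_1 + ⋯ + f_p with each f_ℓ using only the variables x(ℓ). Let u(1),…,u(q) be subsets of {x_0,x_1,…,x_n,w_1,…,w_p} whose union is the whole set, each containing x_0, satisfying the RIP, such that f̃ = F_1 + ⋯ + F_q with each F_ℓ ∈ ℝ[u(ℓ)], there is a partition J_1,…,J_q of {1,…,m} with g̃_j ∈ ℝ[u(ℓ)] whenever j ∈ J_ℓ, and there is a partition I_1,…,I_q of {1,…,p+1} with h'_j ∈ ℝ[u(ℓ)] whenever j ∈ I_ℓ. Then there exist, for each ℓ ∈ {1,…,q}, sums of squares σ_{ℓ,0}, σ_{ℓ,∗} ∈ Σ[u(ℓ)], sums of squares σ_{ℓ,i} ∈ Σ[u(ℓ)] for each variable u_i ∈ u(ℓ), sums of squares σ_{ℓ,j} ∈ Σ[u(ℓ)] for j ∈ J_ℓ,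 and polynomials τ_{ℓ,j} ∈ ℝ[u(ℓ)] for j ∈ I_ℓ, such that f̃ = Σ_{ℓ=1}^q ( σ_{ℓ,0} + x_0·σ_{ℓ,∗} + Σ_{u_i ∈ u(ℓ)} σ_{ℓ,i}·(1 − u_i²) + Σ_{j∈J_ℓ} g̃_j·σ_{ℓ,j} + Σ_{j ∈ I_ℓ} τ_{ℓ,j}·h'_j ) as polynomials in x_0,…,x_n,w_1,…,w_p. -/
open MvPolynomial

/-- `q` is a sum of squares of polynomials using only the variables in `A`. -/
def IsSOSOn {σ : Type*} [DecidableEq σ] (A : Finset σ) (q : MvPolynomial σ ℝ) : Prop :=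
  ∃ (t : ℕ) (h : Fin t → MvPolynomial σ ℝ),
    (∀ i, (h i).vars ⊆ A) ∧ q = ∑ i, (h i) ^ 2

section Putinar

variable {A : Type*} [CommRing A]

/-- A quadratic module of a commutative real algebra. -/
structure IsQuadraticModule (M : Set A) : Prop where
  one_mem : 1 ∈ M
  add_mem : ∀ {a b : A}, a ∈ M → b ∈ M → a + b ∈ M
  sq_mul_mem : ∀ (c : A) {a : A}, a ∈ M → c ^ 2 * a ∈ M

namespace IsQuadraticModule

variable {M : Set A}

theorem sq_mem (hM : IsQuadraticModule M) (c : A) : c ^ 2 ∈ M := by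
  simpa using hM.sq_mul_mem c hM.one_mem

theorem zero_mem (hM : IsQuadraticModule M) : (0 : A) ∈ M := by
  simpa using hM.sq_mem 0

end IsQuadraticModule

variable [Algebra ℝ A]

/-- A set is Archimedean if every element is dominated, modulo the set, by a real constant. -/
def IsArchimedeanSet (M : Set A) : Prop :=
  ∀ a : A, ∃ N : ℝ, N • 1 - a ∈ M

/-- The normalized linear functionals that are nonnegative on `M`, as functions on `A`. -/
def stateSet (M : Set A) : Set (A → ℝ) :=
  {L | (∀ a b, L (a + b) = L a + L b) ∧ (∀ (c : ℝ) a, L (c • a) = c * L a) ∧ L 1 = 1 ∧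
    ∀ a ∈ M, 0 ≤ L a}

namespace IsQuadraticModule

variable {M : Set A}

theorem smul_mem (hM : IsQuadraticModule M) {c : ℝ} (hc : 0 ≤ c) {a : A} (ha : a ∈ M) :
    c • a ∈ M := by
  have h := hM.sq_mul_mem (algebraMap ℝ A (√c)) ha
  rwa [← map_pow, Real.sq_sqrt hc, ← Algebra.smul_def] at h

/-- A functional that is nonnegative on `M` contracts under multiplication by `h ^ 2`
if `1 - h ^ 2 ∈ M`. -/
theorem map_sq_mul_le (hM : IsQuadraticModule M) (hA : IsArchimedeanSet M)
    {L : A →ₗ[ℝ] ℝ} (hL : ∀ a ∈ M, 0 ≤ L a) {h b : A} (hh : 1 - h ^ 2 ∈ M) (hb : b ∈ M) :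
    L (h ^ 2 * b) ≤ L b := by
  set c : ℕ → ℝ := fun k => L ((h ^ k) ^ 2 * b) with hc
  have hconv : ∀ k, 0 ≤ c (k + 2) - 2 * c (k + 1) + c k := by
    intro k
    have h0 := hL _ (hM.sq_mul_mem (h ^ k * (1 - h ^ 2)) hb)
    have h1 : (h ^ k * (1 - h ^ 2)) ^ 2 * b
        = (h ^ (k + 2)) ^ 2 * b - (2 : ℝ) • ((h ^ (k + 1)) ^ 2 * b) + (h ^ k) ^ 2 * b := by
      rw [Algebra.smul_def, map_ofNat]; ring
    rw [h1, map_add, map_sub, map_smul, smul_eq_mul] at h0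
    exact h0
  obtain ⟨N, hN⟩ := hA b
  have hdec : ∀ k, L ((h ^ k) ^ 2) ≤ L 1 := by
    intro k
    induction k with
    | zero => simp
    | succ k ih =>
      have h0 := hL _ (hM.sq_mul_mem (h ^ k) hh)
      have h1 : (h ^ k) ^ 2 * (1 - h ^ 2) = (h ^ k) ^ 2 - (h ^ (k + 1)) ^ 2 := by ring
      rw [h1, map_sub] at h0
      linarith
  have hbd : ∀ k, c k ≤ |N| * L 1 := by
    intro k
    have h0 := hL _ (hM.sq_mul_mem (h ^ k) hN)
    have h1 : (h ^ k) ^ 2 * (N • 1 - b) = N • (h ^ k) ^ 2 - (h ^ k) ^ 2 * b := by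
      rw [Algebra.smul_def, Algebra.smul_def]; ring
    rw [h1, map_sub, map_smul, smul_eq_mul] at h0
    have h2 := hL _ (hM.sq_mem (h ^ k))
    calc c k ≤ N * L ((h ^ k) ^ 2) := by simp only [hc]; linarith
      _ ≤ |N| * L ((h ^ k) ^ 2) := by gcongr; exact le_abs_self N
      _ ≤ |N| * L 1 := by gcongr; exact hdec k
  by_contra hlt
  have h01 : c 0 < c 1 := by simpa [hc] using hlt
  have hinc : ∀ k, c 1 - c 0 ≤ c (k + 1) - c k := by
    intro k
    induction k with
    | zero => simp
    | succ k ih => have := hconv k; linarith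
  have hgrow : ∀ k : ℕ, c 0 + k * (c 1 - c 0) ≤ c k := by
    intro k
    induction k with
    | zero => simp
    | succ k ih => have := hinc k; push_cast; linarith
  obtain ⟨k, hk⟩ := exists_nat_gt ((|N| * L 1 - c 0) / (c 1 - c 0))
  rw [div_lt_iff₀ (by linarith)] at hk
  linarith [hgrow k, hbd k]

theorem isCompact_stateSet (hA : IsArchimedeanSet M) : IsCompact (stateSet M) := by
  choose N hN using hA
  refine IsCompact.of_isClosed_subset
    (isCompact_univ_pi fun a : A => isCompact_Icc (a := -N (-a)) (b := N a)) ?_ ?_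
  · simp only [stateSet, Set.ofPred_and, Set.ofPred_forall]
    refine IsClosed.inter ?_ (IsClosed.inter ?_ (IsClosed.inter ?_ ?_))
    · exact isClosed_iInter fun a => isClosed_iInter fun b =>
        isClosed_eq (by fun_prop) (by fun_prop)
    · exact isClosed_iInter fun a => isClosed_iInter fun b =>
        isClosed_eq (by fun_prop) (by fun_prop)
    · exact isClosed_eq (by fun_prop) (by fun_prop)
    · exact isClosed_iInter fun a => isClosed_iInter fun _ =>
        isClosed_le (by fun_prop) (by fun_prop)
  · rintro L ⟨hadd, hsmul, hone, hpos⟩ a -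
    have key : ∀ a, L a ≤ N a := by
      intro a
      have h := hpos _ (hN a)
      rw [sub_eq_add_neg, ← neg_one_smul ℝ a, hadd, hsmul, hsmul, hone] at h
      linarith
    have h := key (-a)
    rw [← neg_one_smul ℝ a, hsmul] at h
    rw [neg_one_smul] at h
    exact ⟨by linarith, key a⟩

/-- The extreme states of an Archimedean quadratic module are multiplicative. -/
theorem map_mul_of_mem_extremePoints (hM : IsQuadraticModule M) (hA : IsArchimedeanSet M)
    {L : A → ℝ} (hL : L ∈ (stateSet M).extremePoints ℝ) (a b : A) : L (a * b) = L a * L b := by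
  obtain ⟨⟨hadd, hsmul, hone, hpos⟩, hext⟩ := hL
  let Λ : A →ₗ[ℝ] ℝ := ⟨⟨L, hadd⟩, by simpa using hsmul⟩
  have hΛ : ∀ a ∈ M, 0 ≤ Λ a := hpos
  have hsub : ∀ a b, L (a - b) = L a - L b := fun a b => map_sub Λ a b
  have contr : ∀ h, 1 - h ^ 2 ∈ M → ∀ a, L (h ^ 2 * a) = L (h ^ 2) * L a := by
    intro h hh a
    have h0 : 0 ≤ L (h ^ 2) := hpos _ (hM.sq_mem h)
    have h1 : L (h ^ 2) ≤ 1 := by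
      have := hpos _ hh
      rw [hsub, hone] at this; linarith
    set s := L (h ^ 2)
    let L₁ : A → ℝ := fun a => (L a + L (h ^ 2 * a)) / (1 + s)
    let L₂ : A → ℝ := fun a => (2 * L a - L (h ^ 2 * a)) / (2 - s)
    have hs1 : 0 < 1 + s := by linarith
    have hs2 : 0 < 2 - s := by linarith
    have m₁ : L₁ ∈ stateSet M := by
      refine ⟨fun a b => ?_, fun c a => ?_, ?_, fun b hb => ?_⟩
      · simp only [L₁, mul_add, hadd]; ring
      · simp only [L₁, mul_smul_comm, hsmul]; ring
      · simp only [L₁, mul_one, hone]; exact div_self hs1.ne'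
      · exact div_nonneg (add_nonneg (hpos _ hb) (hpos _ (hM.sq_mul_mem h hb))) hs1.le
    have m₂ : L₂ ∈ stateSet M := by
      refine ⟨fun a b => ?_, fun c a => ?_, ?_, fun b hb => ?_⟩
      · simp only [L₂, mul_add, hadd]; ring
      · simp only [L₂, mul_smul_comm, hsmul]; ring
      · simp only [L₂, mul_one, hone]; exact div_self hs2.ne'
      · have hle : L (h ^ 2 * b) ≤ L b := hM.map_sq_mul_le hA hΛ hh hb
        have := hpos _ hb
        exact div_nonneg (by linarith) hs2.le
    have hseg : L ∈ openSegment ℝ L₁ L₂ := by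
      refine ⟨(1 + s) / 3, (2 - s) / 3, by positivity, by positivity, by ring, ?_⟩
      ext a
      simp only [L₁, L₂, Pi.add_apply, Pi.smul_apply, smul_eq_mul]
      field_simp
      ring
    have heq := congrFun (hext m₁ m₂ hseg) a
    simp only [L₁] at heq
    rw [div_eq_iff hs1.ne'] at heq
    linarith
  have hsq : ∀ h a, L (h ^ 2 * a) = L (h ^ 2) * L a := by
    intro h a
    obtain ⟨N, hN⟩ := hA (h ^ 2)
    set R := |N| + 1 with hR
    have hRpos : 0 < R := by positivity
    have hRmem : R • 1 - h ^ 2 ∈ M := by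
      have h1 := hM.add_mem hN
        (hM.smul_mem (c := R - N) (by linarith [le_abs_self N]) hM.one_mem)
      convert h1 using 1
      rw [sub_smul]; abel
    have hsc : ((√R)⁻¹ • h) ^ 2 = R⁻¹ • h ^ 2 := by
      rw [smul_pow, inv_pow, Real.sq_sqrt hRpos.le]
    have h2 : 1 - ((√R)⁻¹ • h) ^ 2 ∈ M := by
      have h3 := hM.smul_mem (inv_nonneg.2 hRpos.le) hRmem
      rwa [smul_sub, smul_smul, inv_mul_cancel₀ hRpos.ne', one_smul, ← hsc] at h3
    have h4 := contr _ h2 a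
    rw [hsc, smul_mul_assoc, hsmul, hsmul, mul_assoc] at h4
    exact mul_left_cancel₀ (inv_ne_zero hRpos.ne') h4
  have e₁ : a * b = (4⁻¹ : ℝ) • ((a + 1) ^ 2 * b - (a - 1) ^ 2 * b) := by
    have : (a + 1) ^ 2 * b - (a - 1) ^ 2 * b = (4 : ℝ) • (a * b) := by
      rw [Algebra.smul_def, map_ofNat]; ring
    rw [this, smul_smul]; norm_num
  have e₂ : a = (4⁻¹ : ℝ) • ((a + 1) ^ 2 - (a - 1) ^ 2) := by
    have : (a + 1) ^ 2 - (a - 1) ^ 2 = (4 : ℝ) • a := by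
      rw [Algebra.smul_def, map_ofNat]; ring
    rw [this, smul_smul]; norm_num
  have l₁ : L (a * b) = 4⁻¹ * (L ((a + 1) ^ 2) * L b - L ((a - 1) ^ 2) * L b) := by
    rw [e₁, hsmul, hsub, hsq, hsq]
  have l₂ : L a = 4⁻¹ * (L ((a + 1) ^ 2) - L ((a - 1) ^ 2)) := by
    conv_lhs => rw [e₂]
    rw [hsmul, hsub]
  rw [l₁, l₂]; ring

/-- An element outside an Archimedean quadratic module is nonpositive in some state. -/
theorem exists_state_of_notMem (hM : IsQuadraticModule M) (hA : IsArchimedeanSet M) {f : A}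
    (hf : f ∉ M) : ∃ L ∈ stateSet M, L f ≤ 0 := by
  have hneg : (-1 : A) ∉ M := by
    intro h
    obtain ⟨N, hN⟩ := hA (-f)
    have h1 := hM.add_mem hN (hM.smul_mem (abs_nonneg N) h)
    have h2 := hM.add_mem h1 (hM.smul_mem (sub_nonneg.2 (le_abs_self N)) hM.one_mem)
    apply hf
    convert h2 using 1
    rw [sub_smul, smul_neg]; abel
  let s : PointedCone ℝ A :=
    { carrier := {x | ∃ m ∈ M, ∃ t : ℝ, 0 ≤ t ∧ x = m - t • f}
      add_mem' := by
        rintro _ _ ⟨m, hm, t, ht, rfl⟩ ⟨m', hm', t', ht', rfl⟩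
        exact ⟨m + m', hM.add_mem hm hm', t + t', add_nonneg ht ht', by rw [add_smul]; abel⟩
      zero_mem' := ⟨0, hM.zero_mem, 0, le_rfl, by simp⟩
      smul_mem' := by
        rintro ⟨c, hc⟩ _ ⟨m, hm, t, ht, rfl⟩
        refine ⟨c • m, hM.smul_mem hc hm, c * t, mul_nonneg hc ht, ?_⟩
        rw [mul_smul, ← smul_sub]
        rfl }
  have hMs : ∀ m ∈ M, m ∈ s := fun m hm => ⟨m, hm, 0, le_rfl, by simp⟩
  have hfs : -f ∈ s := ⟨0, hM.zero_mem, 1, zero_le_one, by simp⟩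
  have hone : (1 : A) ≠ 0 := fun h => hneg (by simpa [h] using hM.zero_mem)
  let φ : A →ₗ.[ℝ] ℝ := LinearPMap.mkSpanSingleton 1 1 hone
  have hφ : ∀ (c : ℝ) (hc : c • (1 : A) ∈ φ.domain), φ ⟨c • 1, hc⟩ = c := by
    intro c hc
    exact (LinearPMap.mkSpanSingleton'_apply _ _ _ c hc).trans (by simp)
  have hdom : ∀ c : ℝ, c • (1 : A) ∈ φ.domain := fun c =>
    Submodule.smul_mem _ _ (Submodule.mem_span_singleton_self _)
  obtain ⟨g, hg, hgs⟩ := riesz_extension s φ (by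
    rintro ⟨x, hx⟩ hxs
    obtain ⟨c, rfl⟩ := Submodule.mem_span_singleton.1 hx
    rw [hφ]
    by_contra! hc
    obtain ⟨m, hm, t, ht, e⟩ := hxs
    have e' : t • f = m + (-c) • 1 := by
      have : c • (1 : A) = m - t • f := e
      rw [neg_smul, this]; abel
    rcases ht.eq_or_lt with rfl | ht
    · apply hneg
      have h1 := hM.smul_mem (c := (-c)⁻¹) (by rw [inv_nonneg]; linarith) hm
      have h2 : m = (-c) • (-1 : A) := by
        rw [zero_smul] at e'
        rw [smul_neg, ← neg_eq_of_add_eq_zero_left e'.symm]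
      rwa [h2, smul_smul, inv_mul_cancel₀ (by linarith), one_smul] at h1
    · apply hf
      have h1 := hM.smul_mem (inv_nonneg.2 ht.le)
        (hM.add_mem hm (hM.smul_mem (c := -c) (by linarith) hM.one_mem))
      rwa [← e', smul_smul, inv_mul_cancel₀ ht.ne', one_smul] at h1) (by
    intro y
    obtain ⟨N, hN⟩ := hA (-y)
    exact ⟨⟨N • 1, hdom N⟩, hMs _ (by simpa using hN)⟩)
  refine ⟨g, ⟨map_add g, fun c a => by simp, ?_, fun a ha => hgs a (hMs a ha)⟩, ?_⟩
  · have h := (hg ⟨(1 : ℝ) • 1, hdom 1⟩).trans (hφ 1 _)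
    simpa using h
  · have h := hgs _ hfs
    rw [map_neg] at h; linarith

/-- **Putinar's Positivstellensatz** (abstract form): an element that is positive under every real
character which is nonnegative on an Archimedean quadratic module belongs to the module. -/
theorem mem_of_forall_character_pos (hM : IsQuadraticModule M) (hA : IsArchimedeanSet M) {f : A}
    (hf : ∀ φ : A →ₐ[ℝ] ℝ, (∀ a ∈ M, 0 ≤ φ a) → 0 < φ f) : f ∈ M := by
  by_contra hfM
  obtain ⟨L₀, hL₀, hL₀f⟩ := hM.exists_state_of_notMem hA hfM
  have hcomp := isCompact_stateSet hA
  have hexp : IsExposed ℝ (stateSet M)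
      {L ∈ stateSet M | ∀ L' ∈ stateSet M, L f ≤ L' f} := fun _ =>
    ⟨-ContinuousLinearMap.proj f, by ext; simp⟩
  obtain ⟨L₁, hL₁, hmin⟩ := hcomp.exists_isMinOn ⟨L₀, hL₀⟩ (continuous_apply f).continuousOn
  obtain ⟨L, hL⟩ := (hexp.isCompact hcomp).extremePoints_nonempty ⟨L₁, hL₁, fun L' hL' => hmin hL'⟩
  have hmul := hM.map_mul_of_mem_extremePoints hA
    (hexp.isExtreme.extremePoints_subset_extremePoints hL)
  obtain ⟨⟨⟨hadd, hsmul, hone, hpos⟩, hle⟩, -⟩ := hL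
  let φ : A →ₐ[ℝ] ℝ := AlgHom.ofLinearMap ⟨⟨L, hadd⟩, by simpa using hsmul⟩ hone hmul
  exact absurd (hf φ hpos) (not_lt.2 ((hle L₀ hL₀).trans hL₀f))

end IsQuadraticModule

end Putinar

section Archimedean

variable {A : Type*} [CommRing A] [Algebra ℝ A] {M : Set A}

/-- The subalgebra of elements whose square is dominated by a constant modulo `M`. -/
def IsQuadraticModule.boundedSubalgebra (hM : IsQuadraticModule M) : Subalgebra ℝ A where
  carrier := {a | ∃ N : ℝ, 0 ≤ N ∧ N • 1 - a ^ 2 ∈ M}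
  algebraMap_mem' c := ⟨c ^ 2, sq_nonneg c, by
    rw [← map_pow, Algebra.algebraMap_eq_smul_one, sub_self]; exact hM.zero_mem⟩
  add_mem' := by
    rintro a b ⟨N, hN, ha⟩ ⟨N', hN', hb⟩
    refine ⟨2 * (N + N'), by positivity, ?_⟩
    convert hM.add_mem (hM.smul_mem zero_le_two (hM.add_mem ha hb)) (hM.sq_mem (a - b)) using 1
    simp only [Algebra.smul_def, map_mul, map_add, map_ofNat]
    ring
  mul_mem' := by
    rintro a b ⟨N, hN, ha⟩ ⟨N', hN', hb⟩
    refine ⟨N * N', by positivity, ?_⟩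
    convert hM.add_mem (hM.smul_mem hN hb) (hM.sq_mul_mem b ha) using 1
    simp only [Algebra.smul_def, map_mul]
    ring

theorem IsQuadraticModule.isArchimedeanSet (hM : IsQuadraticModule M)
    (h : hM.boundedSubalgebra = ⊤) : IsArchimedeanSet M := by
  intro a
  obtain ⟨N, -, ha⟩ : a ∈ hM.boundedSubalgebra := h ▸ Algebra.mem_top
  refine ⟨N + 2⁻¹ ^ 2, ?_⟩
  convert hM.add_mem ha (hM.sq_mem (a - (2⁻¹ : ℝ) • 1)) using 1
  have h2 : algebraMap ℝ A 2⁻¹ * 2 = 1 := by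
    rw [← map_ofNat (algebraMap ℝ A) 2, ← map_mul]; norm_num
  simp only [Algebra.smul_def, map_add, map_pow]
  linear_combination a * h2

theorem IsQuadraticModule.isArchimedeanSet_mvPolynomial {τ : Type*} {M : Set (MvPolynomial τ ℝ)}
    (hM : IsQuadraticModule M) (h : ∀ i, 1 - X i ^ 2 ∈ M) : IsArchimedeanSet M := by
  refine hM.isArchimedeanSet (top_le_iff.1 ?_)
  rw [← adjoin_range_X, Algebra.adjoin_le_iff]
  rintro _ ⟨i, rfl⟩
  exact ⟨1, zero_le_one, by simpa using h i⟩

end Archimedean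

section Separation

theorem IsCompact.exists_between_of_forall_lt {s t : Set ℝ} (hs : IsCompact s) (ht : IsCompact t)
    (h : ∀ a ∈ s, ∀ b ∈ t, a < b) : ∃ c, (∀ a ∈ s, a < c) ∧ ∀ b ∈ t, c < b := by
  rcases s.eq_empty_or_nonempty with rfl | hs'
  · obtain ⟨c, hc⟩ := ht.bddBelow
    exact ⟨c - 1, by simp, fun b hb => by linarith [hc hb]⟩
  · obtain ⟨a, ha, hmax⟩ := hs.exists_isGreatest hs'
    obtain ⟨c, hac, hc⟩ := ht.exists_forall_le' continuousOn_id (h a ha)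
    obtain ⟨d, had, hdc⟩ := exists_between hac
    exact ⟨d, fun x hx => (hmax hx).trans_lt had, fun b hb => hdc.trans_le (hc b hb)⟩

/-- Functions on compact sets that are strictly ordered over each common image point can be
separated by a continuous function of the image point. -/
theorem exists_continuousMap_between {Y Z : Type*} [TopologicalSpace Y]
    [TopologicalSpace Z] [T2Space Z] [NormalSpace Z] [ParacompactSpace Z] {S T : Set Y}
    (hS : IsCompact S) (hT : IsCompact T) {π : Y → Z} (hπ : Continuous π) {a b : Y → ℝ}
    (ha : Continuous a) (hb : Continuous b) (h : ∀ x ∈ S, ∀ y ∈ T, π x = π y → a x < b y) :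
    ∃ φ : C(Z, ℝ), (∀ x ∈ S, a x < φ (π x)) ∧ ∀ y ∈ T, φ (π y) < b y := by
  obtain ⟨φ, hφ⟩ := exists_continuous_forall_mem_convex_of_local_const
    (t := fun z : Z => {c : ℝ | (∀ x ∈ S, π x = z → a x < c) ∧ ∀ y ∈ T, π y = z → c < b y}) (by
      refine fun z => Set.OrdConnected.convex ⟨?_⟩
      rintro c ⟨hc, -⟩ d ⟨-, hd⟩ e ⟨hce, hed⟩
      exact ⟨fun x hx hz => (hc x hx hz).trans_le hce, fun y hy hz => hed.trans_lt (hd y hy hz)⟩) (by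
      intro z
      have hfib : IsClosed (π ⁻¹' {z}) := isClosed_singleton.preimage hπ
      obtain ⟨c, hc, hc'⟩ := ((hS.inter_right hfib).image ha).exists_between_of_forall_lt
        ((hT.inter_right hfib).image hb) (by
          rintro _ ⟨x, ⟨hx, hxz⟩, rfl⟩ _ ⟨y, ⟨hy, hyz⟩, rfl⟩
          exact h x hx y hy (hxz.trans hyz.symm))
      have h₁ := ((hS.inter_right (isClosed_le (continuous_const (y := c)) ha)).image hπ).isClosed
      have h₂ := ((hT.inter_right (isClosed_le hb (continuous_const (y := c)))).image hπ).isClosed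
      refine ⟨c, ?_⟩
      have n₁ : ∀ᶠ w in nhds z, w ∉ π '' (S ∩ {x | c ≤ a x}) := by
        refine h₁.isOpen_compl.mem_nhds ?_
        rintro ⟨x, ⟨hx, hcx⟩, hxz⟩
        exact absurd (hc _ ⟨x, ⟨hx, hxz⟩, rfl⟩) (not_lt.2 hcx)
      have n₂ : ∀ᶠ w in nhds z, w ∉ π '' (T ∩ {y | b y ≤ c}) := by
        refine h₂.isOpen_compl.mem_nhds ?_
        rintro ⟨x, ⟨hx, hcx⟩, hxz⟩
        exact absurd (hc' _ ⟨x, ⟨hx, hxz⟩, rfl⟩) (not_lt.2 hcx)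
      filter_upwards [n₁, n₂] with w hw₁ hw₂
      refine ⟨fun x hx hxw => ?_, fun y hy hyw => ?_⟩
      · by_contra! hlt
        exact hw₁ ⟨x, ⟨hx, hlt⟩, hxw⟩
      · by_contra! hlt
        exact hw₂ ⟨y, ⟨hy, hlt⟩, hyw⟩)
  exact ⟨φ, fun x hx => (hφ _).1 x hx rfl, fun y hy => (hφ _).2 y hy rfl⟩

/-- Polynomials are dense, uniformly on compact sets, in the continuous functions on `τ → ℝ`. -/
theorem exists_mvPolynomial_near {τ : Type*} (φ : C(τ → ℝ, ℝ)) {S : Set (τ → ℝ)}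
    (hS : IsCompact S) {ε : ℝ} (hε : 0 < ε) :
    ∃ p : MvPolynomial τ ℝ, ∀ x ∈ S, |eval x p - φ x| < ε := by
  let Ψ : MvPolynomial τ ℝ →ₐ[ℝ] C(τ → ℝ, ℝ) :=
    aeval fun i => ⟨fun x => x i, continuous_apply i⟩
  have hΨ : ∀ p x, Ψ p x = eval x p := by
    intro p x
    have : ((ContinuousMap.evalAlgHom ℝ ℝ x).comp Ψ) = aeval x := by
      ext i; simp [Ψ]
    exact (DFunLike.congr_fun this p).trans (by simp [aeval_eq_eval])
  have hsep : Ψ.range.SeparatesPoints := by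
    intro x y hxy
    obtain ⟨i, hi⟩ := Function.ne_iff.1 hxy
    exact ⟨_, ⟨Ψ (X i), ⟨X i, rfl⟩, rfl⟩, by simpa [hΨ] using hi⟩
  obtain ⟨_, ⟨p, rfl⟩, hp⟩ :=
    ContinuousMap.exists_mem_subalgebra_near_continuous_of_isCompact_of_separatesPoints hsep φ hS hε
  exact ⟨p, fun x hx => by simpa [hΨ] using hp x hx⟩

variable {σ : Type*} [Fintype σ]

theorem exists_supported_between {V : Set σ} {S T : Set (σ → ℝ)} (hS : IsCompact S)
    (hT : IsCompact T) {a b : (σ → ℝ) → ℝ} (ha : Continuous a) (hb : Continuous b)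
    (h : ∀ x ∈ S, ∀ y ∈ T, (∀ v ∈ V, x v = y v) → a x < b y) :
    ∃ p ∈ supported ℝ V, (∀ x ∈ S, a x < eval x p) ∧ ∀ y ∈ T, eval y p < b y := by
  let π : (σ → ℝ) → (V → ℝ) := fun x v => x v
  have hπ : Continuous π := by fun_prop
  obtain ⟨φ, hφS, hφT⟩ := exists_continuousMap_between hS hT hπ ha hb
    fun x hx y hy hxy => h x hx y hy fun v hv => congrFun hxy ⟨v, hv⟩
  have hφπ : Continuous fun x => φ (π x) := φ.continuous.comp hπ
  obtain ⟨ε, hε, hεS⟩ := hS.exists_forall_le' (hφπ.sub ha).continuousOn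
    (a := 0) fun x hx => sub_pos.2 (hφS x hx)
  obtain ⟨δ, hδ, hδT⟩ := hT.exists_forall_le' (hb.sub hφπ).continuousOn
    (a := 0) fun x hx => sub_pos.2 (hφT x hx)
  obtain ⟨p, hp⟩ := exists_mvPolynomial_near φ ((hS.union hT).image hπ) (lt_min hε hδ)
  have heval : ∀ x, eval x (rename (Subtype.val : V → σ) p) = eval (π x) p := fun x =>
    eval_rename _ _ _
  refine ⟨rename Subtype.val p, ?_, fun x hx => ?_, fun y hy => ?_⟩
  · rw [supported_eq_range_rename]
    exact ⟨p, rfl⟩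
  · have h₁ := hp _ ⟨x, Or.inl hx, rfl⟩
    rw [abs_lt] at h₁
    rw [heval]
    have h₂ : ε ≤ φ (π x) - a x := hεS x hx
    linarith [min_le_left ε δ]
  · have h₁ := hp _ ⟨y, Or.inr hy, rfl⟩
    rw [abs_lt] at h₁
    rw [heval]
    have h₂ : δ ≤ b y - φ (π y) := hδT y hy
    linarith [min_le_right ε δ]

theorem eval_eq_of_mem_supported {σ : Type*} {U : Set σ} {p : MvPolynomial σ ℝ}
    (hp : p ∈ supported ℝ U) {x y : σ → ℝ} (h : ∀ v ∈ U, x v = y v) : eval x p = eval y p :=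
  eval₂Hom_congr' rfl (fun i hi _ => h i (mem_supported.1 hp hi)) rfl

/-- If the cliques `U` have the running intersection property, a sparse sum of polynomials that is
positive on a sparse compact set is a sum of sparse polynomials, each positive on the
corresponding constraint set. -/
theorem exists_sparse_positive_decomposition {U : ℕ → Set σ} {B : Set ℝ} (hB : IsCompact B)
    {T : ℕ → Set (σ → ℝ)} (hT : ∀ ℓ, IsClosed (T ℓ))
    (hTU : ∀ ℓ x y, (∀ v ∈ U ℓ, x v = y v) → x ∈ T ℓ → y ∈ T ℓ) (k : ℕ)
    (hRIP : ∀ ℓ < k, ∃ s ≤ ℓ, ∀ j ≤ ℓ, U (ℓ + 1) ∩ U j ⊆ U s)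
    (f : ℕ → MvPolynomial σ ℝ) (hf : ∀ ℓ, f ℓ ∈ supported ℝ (U ℓ))
    (hpos : ∀ x, (∀ v, x v ∈ B) → (∀ ℓ ≤ k, x ∈ T ℓ) →
      0 < eval x (∑ ℓ ∈ Finset.range (k + 1), f ℓ)) :
    ∃ g : ℕ → MvPolynomial σ ℝ, (∀ ℓ, g ℓ ∈ supported ℝ (U ℓ)) ∧
      ∑ ℓ ∈ Finset.range (k + 1), f ℓ = ∑ ℓ ∈ Finset.range (k + 1), g ℓ ∧
      ∀ ℓ ≤ k, ∀ x, (∀ v, x v ∈ B) → x ∈ T ℓ → 0 < eval x (g ℓ) := by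
  classical
  induction k generalizing f with
  | zero =>
    refine ⟨f, hf, rfl, fun ℓ hℓ x hxB hx => ?_⟩
    obtain rfl : ℓ = 0 := by omega
    simpa using hpos x hxB fun j hj => by rwa [Nat.le_zero.1 hj]
  | succ k ih =>
    have hcube : IsCompact {x : σ → ℝ | ∀ v, x v ∈ B} := by
      simpa [Set.pi] using isCompact_univ_pi fun _ : σ => hB
    let W : Set σ := {v | ∃ j ≤ k, v ∈ U j}
    obtain ⟨s, hsk, hs⟩ := hRIP k (Nat.lt_succ_self k)
    obtain ⟨p, hpV, hpS, hpT⟩ := exists_supported_between (V := U (k + 1) ∩ W)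
      (hcube.inter_right (hT (k + 1)))
      (hcube.inter_right (isClosed_iInter fun j => isClosed_iInter fun _ : j ≤ k => hT j))
      (a := fun x => -eval x (f (k + 1)))
      (b := fun y => eval y (∑ ℓ ∈ Finset.range (k + 1), f ℓ))
      (continuous_eval _).neg (continuous_eval _) (by
        rintro x ⟨hxB, hxT⟩ y ⟨hyB, hyT⟩ hxy
        simp only [Set.mem_iInter] at hyT
        let z : σ → ℝ := fun v => if v ∈ W then y v else x v
        have hzy : ∀ j ≤ k, ∀ v ∈ U j, y v = z v := fun j hj v hv =>
          (if_pos (⟨j, hj, hv⟩ : v ∈ W)).symm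
        have hzx : ∀ v ∈ U (k + 1), x v = z v := by
          intro v hv
          by_cases hvW : v ∈ W
          · simp only [z, if_pos hvW]; exact hxy v ⟨hv, hvW⟩
          · simp only [z, if_neg hvW]
        have hz := hpos z
          (fun v => by by_cases hvW : v ∈ W <;> simp only [z, hvW, if_true, if_false] <;>
            first | exact hyB v | exact hxB v)
          (fun j hj => by
            rcases Nat.le_succ_iff.1 hj with hj | rfl
            · exact hTU j y z (hzy j hj) (hyT j hj)
            · exact hTU _ x z hzx hxT)
        rw [Finset.sum_range_succ, map_add, ← eval_eq_of_mem_supported (hf (k + 1)) hzx,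
          map_sum] at hz
        rw [map_sum]
        have : ∑ ℓ ∈ Finset.range (k + 1), eval y (f ℓ)
            = ∑ ℓ ∈ Finset.range (k + 1), eval z (f ℓ) :=
          Finset.sum_congr rfl fun j hj => eval_eq_of_mem_supported (hf j)
            (hzy j (Nat.lt_succ_iff.1 (Finset.mem_range.1 hj)))
        linarith)
    have hps : p ∈ supported ℝ (U s) := by
      refine supported_mono ?_ hpV
      rintro v ⟨hv, j, hj, hvj⟩
      exact hs j hj ⟨hv, hvj⟩
    have hsum : ∑ ℓ ∈ Finset.range (k + 1), (f - Pi.single s p : ℕ → MvPolynomial σ ℝ) ℓ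
        = ∑ ℓ ∈ Finset.range (k + 1), f ℓ - p := by
      simp only [Pi.sub_apply, Finset.sum_sub_distrib]
      rw [Finset.sum_pi_single', if_pos (Finset.mem_range.2 (by omega))]
    obtain ⟨g, hgU, hgsum, hgpos⟩ := ih (fun ℓ hℓ => hRIP ℓ (by omega)) (f - Pi.single s p)
      (fun ℓ => by
        refine Subalgebra.sub_mem _ (hf ℓ) ?_
        by_cases h : ℓ = s
        · subst h; simpa using hps
        · rw [Pi.single_eq_of_ne h]; exact Subalgebra.zero_mem _)
      (fun x hxB hxT => by
        rw [hsum, map_sub, sub_pos]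
        exact hpT x ⟨hxB, by simpa using hxT⟩)
    refine ⟨Function.update g (k + 1) (f (k + 1) + p), fun ℓ => ?_, ?_, fun ℓ hℓ x hxB hx => ?_⟩
    · by_cases h : ℓ = k + 1
      · subst h
        rw [Function.update_self]
        exact Subalgebra.add_mem _ (hf _) (supported_mono Set.inter_subset_left hpV)
      · rw [Function.update_of_ne h]; exact hgU ℓ
    · rw [Finset.sum_range_succ, Finset.sum_range_succ _ (k + 1), Function.update_self]
      have : ∑ ℓ ∈ Finset.range (k + 1), Function.update g (k + 1) (f (k + 1) + p) ℓ
          = ∑ ℓ ∈ Finset.range (k + 1), g ℓ :=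
        Finset.sum_congr rfl fun j hj =>
          Function.update_of_ne (Finset.mem_range.1 hj).ne _ _
      rw [this, ← hgsum, hsum]
      ring
    · rcases Nat.le_succ_iff.1 hℓ with hℓ | rfl
      · rw [Function.update_of_ne (by omega)]
        exact hgpos ℓ hℓ x hxB hx
      · rw [Function.update_self, map_add]
        linarith [hpS x ⟨hxB, hx⟩]

/-- The version of `exists_sparse_positive_decomposition` for cliques indexed by `Fin q`. -/
theorem exists_sparse_positive_decomposition_fin {q : ℕ} {U : Fin q → Set σ} {B : Set ℝ}
    (hB : IsCompact B) {T : Fin q → Set (σ → ℝ)} (hT : ∀ ℓ, IsClosed (T ℓ))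
    (hTU : ∀ ℓ x y, (∀ v ∈ U ℓ, x v = y v) → x ∈ T ℓ → y ∈ T ℓ) (hq : 1 ≤ q)
    (hRIP : ∀ (ℓ : Fin q) (h : (ℓ : ℕ) + 1 < q), ∃ s ≤ ℓ, ∀ j ≤ ℓ, U ⟨ℓ + 1, h⟩ ∩ U j ⊆ U s)
    (f : Fin q → MvPolynomial σ ℝ) (hf : ∀ ℓ, f ℓ ∈ supported ℝ (U ℓ))
    (hpos : ∀ x, (∀ v, x v ∈ B) → (∀ ℓ, x ∈ T ℓ) → 0 < eval x (∑ ℓ, f ℓ)) :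
    ∃ g : Fin q → MvPolynomial σ ℝ, (∀ ℓ, g ℓ ∈ supported ℝ (U ℓ)) ∧ ∑ ℓ, f ℓ = ∑ ℓ, g ℓ ∧
      ∀ ℓ x, (∀ v, x v ∈ B) → x ∈ T ℓ → 0 < eval x (g ℓ) := by
  obtain ⟨k, rfl⟩ : ∃ k, q = k + 1 := ⟨q - 1, by omega⟩
  let f' : ℕ → MvPolynomial σ ℝ := fun ℓ => if h : ℓ < k + 1 then f ⟨ℓ, h⟩ else 0
  have hsum : ∑ ℓ ∈ Finset.range (k + 1), f' ℓ = ∑ ℓ, f ℓ := by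
    rw [Finset.sum_range]
    exact Finset.sum_congr rfl fun ℓ _ => dif_pos ℓ.2
  obtain ⟨g, hgU, hgsum, hgpos⟩ := exists_sparse_positive_decomposition
    (U := fun ℓ => {v | ∃ h : ℓ < k + 1, v ∈ U ⟨ℓ, h⟩}) hB
    (T := fun ℓ => {x | ∀ h : ℓ < k + 1, x ∈ T ⟨ℓ, h⟩})
    (fun ℓ => by
      simp only [Set.ofPred_forall]
      exact isClosed_iInter fun h => hT _)
    (fun ℓ x y hxy hx h => hTU _ x y (fun v hv => hxy v ⟨h, hv⟩) (hx h)) k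
    (fun ℓ hℓ => by
      obtain ⟨s, hs, hsub⟩ := hRIP ⟨ℓ, by omega⟩ (by simpa using hℓ)
      refine ⟨s, hs, ?_⟩
      rintro j hj v ⟨⟨_, hv⟩, ⟨hj', hvj⟩⟩
      exact ⟨s.2, hsub ⟨j, hj'⟩ hj ⟨hv, hvj⟩⟩)
    f'
    (fun ℓ => by
      by_cases h : ℓ < k + 1
      · simp only [f', dif_pos h]
        refine supported_mono ?_ (hf ⟨ℓ, h⟩)
        exact fun v hv => ⟨h, hv⟩
      · simp only [f', dif_neg h]
        exact Subalgebra.zero_mem _)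
    (fun x hxB hxT => by
      rw [hsum]
      exact hpos x hxB fun ℓ => hxT ℓ (Nat.lt_succ_iff.1 ℓ.2) ℓ.2)
  refine ⟨fun ℓ => g ℓ, fun ℓ => supported_mono ?_ (hgU ℓ), ?_, fun ℓ x hxB hx =>
    hgpos ℓ (Nat.lt_succ_iff.1 ℓ.2) x hxB fun _ => hx⟩
  · rintro v ⟨_, hv⟩
    exact hv
  · rw [← hsum, hgsum, Finset.sum_range]

end Separation

section Clique

theorem vars_rename_val_subset {σ : Type*} {U : Finset σ} (c : MvPolynomial U ℝ) :
    (rename (Subtype.val : U → σ) c).vars ⊆ U := by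
  intro v hv
  obtain ⟨w, -, rfl⟩ := mem_vars_rename _ _ hv
  exact w.2

variable {σ : Type*} [DecidableEq σ] {U : Finset σ}

namespace IsSOSOn

theorem zero : IsSOSOn U (0 : MvPolynomial σ ℝ) :=
  ⟨0, Fin.elim0, fun i => i.elim0, by simp⟩

theorem sq {c : MvPolynomial σ ℝ} (hc : c.vars ⊆ U) : IsSOSOn U (c ^ 2) :=
  ⟨1, fun _ => c, fun _ => hc, by simp⟩

theorem one : IsSOSOn U (1 : MvPolynomial σ ℝ) := by
  simpa using sq (U := U) (c := (1 : MvPolynomial σ ℝ)) (by simp)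

theorem add {a b : MvPolynomial σ ℝ} (ha : IsSOSOn U a) (hb : IsSOSOn U b) :
    IsSOSOn U (a + b) := by
  obtain ⟨t, h, hU, rfl⟩ := ha
  obtain ⟨t', h', hU', rfl⟩ := hb
  refine ⟨t + t', Fin.append h h', fun i => ?_, by simp [Fin.sum_univ_add]⟩
  induction i using Fin.addCases with
  | left i => simpa using hU i
  | right i => simpa using hU' i

theorem sq_mul {c a : MvPolynomial σ ℝ} (hc : c.vars ⊆ U) (ha : IsSOSOn U a) :
    IsSOSOn U (c ^ 2 * a) := by
  obtain ⟨t, h, hU, rfl⟩ := ha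
  refine ⟨t, fun i => c * h i, fun i => ?_, by simp [Finset.mul_sum, mul_pow]⟩
  exact (vars_mul _ _).trans (Finset.union_subset hc (hU i))

theorem single {ι : Type*} [DecidableEq ι] (i j : ι) :
    IsSOSOn U ((Pi.single i 1 : ι → MvPolynomial σ ℝ) j) := by
  by_cases h : j = i
  · subst h; simpa using one
  · rw [Pi.single_eq_of_ne h]; exact zero

end IsSOSOn

variable {ι κ : Type*}

/-- The polynomials in the variables `U` with a Putinar certificate for the constraints
`0 ≤ v₀`, `v ^ 2 ≤ 1` (`v ∈ U`), `0 ≤ G j` (`j ∈ J`) and `H j = 0` (`j ∈ I`). -/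
def cliqueModule (U : Finset σ) (v₀ : σ) (J : Finset ι) (G : ι → MvPolynomial σ ℝ) (I : Finset κ)
    (H : κ → MvPolynomial σ ℝ) : Set (MvPolynomial U ℝ) :=
  {a | ∃ (σ0 σs : MvPolynomial σ ℝ) (σu : σ → MvPolynomial σ ℝ) (σg : ι → MvPolynomial σ ℝ)
      (τ : κ → MvPolynomial σ ℝ),
      IsSOSOn U σ0 ∧ IsSOSOn U σs ∧ (∀ v, IsSOSOn U (σu v)) ∧ (∀ j, IsSOSOn U (σg j)) ∧
      (∀ j, (τ j).vars ⊆ U) ∧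
      rename Subtype.val a = σ0 + X v₀ * σs + ∑ v ∈ U, σu v * (1 - X v ^ 2)
        + ∑ j ∈ J, G j * σg j + ∑ j ∈ I, τ j * H j}

variable {v₀ : σ} {J : Finset ι} {G : ι → MvPolynomial σ ℝ} {I : Finset κ}
  {H : κ → MvPolynomial σ ℝ}

theorem isQuadraticModule_cliqueModule : IsQuadraticModule (cliqueModule U v₀ J G I H) where
  one_mem := ⟨1, 0, 0, 0, 0, .one, .zero, fun _ => .zero, fun _ => .zero, by simp, by simp⟩
  add_mem := by
    rintro a b ⟨σ0, σs, σu, σg, τ, h0, hs, hu, hg, hτ, e⟩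
      ⟨σ0', σs', σu', σg', τ', h0', hs', hu', hg', hτ', e'⟩
    refine ⟨σ0 + σ0', σs + σs', σu + σu', σg + σg', τ + τ', h0.add h0', hs.add hs',
      fun v => (hu v).add (hu' v), fun j => (hg j).add (hg' j),
      fun j => (vars_add_subset _ _).trans (Finset.union_subset (hτ j) (hτ' j)), ?_⟩
    rw [map_add, e, e']
    simp only [Pi.add_apply, add_mul, mul_add, Finset.sum_add_distrib]
    ring
  sq_mul_mem := by
    rintro c a ⟨σ0, σs, σu, σg, τ, h0, hs, hu, hg, hτ, e⟩
    have hc := vars_rename_val_subset c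
    set d := rename Subtype.val c with hd
    refine ⟨d ^ 2 * σ0, d ^ 2 * σs, fun v => d ^ 2 * σu v, fun j => d ^ 2 * σg j,
      fun j => d ^ 2 * τ j, h0.sq_mul hc, hs.sq_mul hc, fun v => (hu v).sq_mul hc,
      fun j => (hg j).sq_mul hc, fun j => (vars_mul _ _).trans
        (Finset.union_subset ((vars_pow _ _).trans hc) (hτ j)), ?_⟩
    rw [map_mul, map_pow, ← hd, e]
    simp only [mul_add, Finset.mul_sum, mul_assoc, mul_left_comm (d ^ 2)]

theorem mem_cliqueModule_of_rename_eq_X {a : MvPolynomial U ℝ}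
    (ha : rename Subtype.val a = (X v₀ : MvPolynomial σ ℝ)) : a ∈ cliqueModule U v₀ J G I H :=
  ⟨0, 1, 0, 0, 0, .zero, .one, fun _ => .zero, fun _ => .zero, by simp, by simp [ha]⟩

theorem one_sub_X_sq_mem_cliqueModule (v : U) : 1 - X v ^ 2 ∈ cliqueModule U v₀ J G I H :=
  ⟨0, 0, Pi.single v.1 1, 0, 0, .zero, .zero, fun w => .single _ w, fun _ => .zero, by simp, by
    simp [Pi.single_apply]⟩

theorem mem_cliqueModule_of_rename_eq_ineq [DecidableEq ι] {a : MvPolynomial U ℝ} {j : ι}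
    (hj : j ∈ J) (ha : rename Subtype.val a = G j) : a ∈ cliqueModule U v₀ J G I H :=
  ⟨0, 0, 0, Pi.single j 1, 0, .zero, .zero, fun _ => .zero, fun i => .single _ i, by simp, by
    simp [Pi.single_apply, ha, hj]⟩

theorem mem_cliqueModule_of_rename_eq_mul [DecidableEq κ] {a : MvPolynomial U ℝ} {j : κ}
    (hj : j ∈ I) {c : ℝ} (ha : rename Subtype.val a = C c * H j) :
    a ∈ cliqueModule U v₀ J G I H := by
  refine ⟨0, 0, 0, 0, Pi.single j (C c), .zero, .zero, fun _ => .zero, fun _ => .zero,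
    fun i => ?_, by simp [Pi.single_apply, ha, hj]⟩
  by_cases h : i = j
  · subst h; simp
  · rw [Pi.single_eq_of_ne h]; simp

/-- **Putinar's Positivstellensatz** for one clique of variables. -/
theorem exists_mem_cliqueModule (hv₀ : v₀ ∈ U) (hG : ∀ j ∈ J, (G j).vars ⊆ U)
    (hH : ∀ j ∈ I, (H j).vars ⊆ U) {g : MvPolynomial σ ℝ} (hg : g.vars ⊆ U)
    (hpos : ∀ x : σ → ℝ, (∀ v, x v ∈ Set.Icc (-1) 1) → 0 ≤ x v₀ → (∀ j ∈ J, 0 ≤ eval x (G j)) →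
      (∀ j ∈ I, eval x (H j) = 0) → 0 < eval x g) :
    ∃ a ∈ cliqueModule U v₀ J G I H, rename Subtype.val a = g := by
  classical
  have hM : IsQuadraticModule (cliqueModule U v₀ J G I H) := isQuadraticModule_cliqueModule
  have lift : ∀ b : MvPolynomial σ ℝ, b.vars ⊆ U →
      ∃ a : MvPolynomial U ℝ, rename Subtype.val a = b := fun b hb =>
    exists_rename_eq_of_vars_subset_range b _ Subtype.val_injective (by simpa using hb)
  obtain ⟨a, rfl⟩ := lift g hg
  refine ⟨a, hM.mem_of_forall_character_pos
    (hM.isArchimedeanSet_mvPolynomial one_sub_X_sq_mem_cliqueModule) fun φ hφ => ?_, rfl⟩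
  let x : σ → ℝ := fun v => if h : v ∈ U then φ (X ⟨v, h⟩) else 0
  have hx : ∀ b : MvPolynomial U ℝ, eval x (rename Subtype.val b) = φ b := by
    intro b
    have hφ' : φ = aeval fun v : U => x v := by
      ext v
      simp [x]
    rw [eval_rename, hφ', aeval_eq_eval]
    rfl
  rw [← hx]
  refine hpos x (fun v => ?_) ?_ (fun j hj => ?_) fun j hj => ?_
  · by_cases h : v ∈ U
    · have h1 := hφ _ (one_sub_X_sq_mem_cliqueModule ⟨v, h⟩)
      rw [map_sub, map_one, map_pow, sub_nonneg, sq_le_one_iff_abs_le_one, abs_le] at h1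
      simpa only [x, dif_pos h, Set.mem_Icc] using h1
    · simp [x, h]
  · have h1 := hφ (X ⟨v₀, hv₀⟩) (mem_cliqueModule_of_rename_eq_X (by simp))
    simpa only [x, dif_pos hv₀] using h1
  · obtain ⟨b, hb⟩ := lift _ (hG j hj)
    rw [← hb, hx]
    exact hφ b (mem_cliqueModule_of_rename_eq_ineq hj hb)
  · obtain ⟨b, hb⟩ := lift _ (hH j hj)
    rw [← hb, hx]
    refine le_antisymm ?_ (hφ b (mem_cliqueModule_of_rename_eq_mul hj (c := 1) (by simp [hb])))
    have h1 := hφ (-b) (mem_cliqueModule_of_rename_eq_mul hj (c := -1) (by simp [hb]))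
    rw [map_neg] at h1
    linarith

/-- **Sparse Putinar Positivstellensatz**: if the cliques `U` have the running intersection
property, a sparse polynomial that is positive on the sparse basic semialgebraic set has a sparse
certificate. -/
theorem exists_sparse_certificate [Fintype σ] [Fintype ι] [Fintype κ] {q : ℕ} (hq : 1 ≤ q)
    {U : Fin q → Finset σ} (hv₀ : ∀ ℓ, v₀ ∈ U ℓ)
    (hRIP : ∀ (ℓ : Fin q) (h : (ℓ : ℕ) + 1 < q), ∃ s : Fin q, s ≤ ℓ ∧
      U ⟨(ℓ : ℕ) + 1, h⟩ ∩ (Finset.Iic ℓ).biUnion U ⊆ U s)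
    (cl : ι → Fin q) (hG : ∀ j, (G j).vars ⊆ U (cl j))
    (iCl : κ → Fin q) (hH : ∀ j, (H j).vars ⊆ U (iCl j))
    (f : Fin q → MvPolynomial σ ℝ) (hf : ∀ ℓ, (f ℓ).vars ⊆ U ℓ)
    (hpos : ∀ x : σ → ℝ, 0 ≤ x v₀ → (∀ j, 0 ≤ eval x (G j)) → (∀ j, eval x (H j) = 0) →
      0 < eval x (∑ ℓ, f ℓ)) :
    ∃ (σ0 σs : Fin q → MvPolynomial σ ℝ) (σu : Fin q → σ → MvPolynomial σ ℝ)
      (σg : ι → MvPolynomial σ ℝ) (τ : κ → MvPolynomial σ ℝ),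
      (∀ ℓ, IsSOSOn (U ℓ) (σ0 ℓ)) ∧ (∀ ℓ, IsSOSOn (U ℓ) (σs ℓ)) ∧
      (∀ ℓ, ∀ v ∈ U ℓ, IsSOSOn (U ℓ) (σu ℓ v)) ∧ (∀ j, IsSOSOn (U (cl j)) (σg j)) ∧
      (∀ j, (τ j).vars ⊆ U (iCl j)) ∧
      ∑ ℓ, f ℓ = (∑ ℓ, (σ0 ℓ + X v₀ * σs ℓ + ∑ v ∈ U ℓ, σu ℓ v * (1 - (X v) ^ 2)))
        + (∑ j, G j * σg j) + ∑ j, τ j * H j := by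
  obtain ⟨g, hgU, hfg, hgpos⟩ := exists_sparse_positive_decomposition_fin
    (U := fun ℓ => (U ℓ : Set σ)) (B := Set.Icc (-1) 1) isCompact_Icc
    (T := fun ℓ => {x | 0 ≤ x v₀ ∧ (∀ j, cl j = ℓ → 0 ≤ eval x (G j)) ∧
      ∀ j, iCl j = ℓ → eval x (H j) = 0})
    (fun ℓ => by
      simp only [Set.ofPred_and, Set.ofPred_forall]
      refine (isClosed_le continuous_const (continuous_apply _)).inter (.inter ?_ ?_)
      · exact isClosed_iInter fun j => isClosed_iInter fun _ =>
          isClosed_le continuous_const (continuous_eval _)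
      · exact isClosed_iInter fun j => isClosed_iInter fun _ =>
          isClosed_eq (continuous_eval _) continuous_const)
    (by
      rintro ℓ x y hxy ⟨h0, hG', hH'⟩
      refine ⟨hxy v₀ (hv₀ ℓ) ▸ h0, ?_, ?_⟩
      · rintro j rfl
        rw [← eval_eq_of_mem_supported (mem_supported.2 (Finset.coe_subset.2 (hG j))) hxy]
        exact hG' j rfl
      · rintro j rfl
        rw [← eval_eq_of_mem_supported (mem_supported.2 (Finset.coe_subset.2 (hH j))) hxy]
        exact hH' j rfl)
    hq
    (fun ℓ h => by
      obtain ⟨s, hs, hsub⟩ := hRIP ℓ h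
      refine ⟨s, hs, ?_⟩
      rintro j hj v ⟨hv, hvj⟩
      exact hsub (Finset.mem_inter.2 ⟨hv, Finset.mem_biUnion.2 ⟨j, Finset.mem_Iic.2 hj, hvj⟩⟩))
    f (fun ℓ => mem_supported.2 (Finset.coe_subset.2 (hf ℓ)))
    (fun x _ hx => hpos x (hx ⟨0, hq⟩).1 (fun j => (hx _).2.1 j rfl) fun j => (hx _).2.2 j rfl)
  have hcert : ∀ ℓ, ∃ a ∈ cliqueModule (U ℓ) v₀ {j | cl j = ℓ} G {j | iCl j = ℓ} H,
      rename Subtype.val a = g ℓ := fun ℓ => by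
    refine exists_mem_cliqueModule (hv₀ ℓ) ?_ ?_ (Finset.coe_subset.1 (mem_supported.1 (hgU ℓ))) ?_
    · simp only [Finset.mem_filter_univ]
      rintro j rfl
      exact hG j
    · simp only [Finset.mem_filter_univ]
      rintro j rfl
      exact hH j
    · simp only [Finset.mem_filter_univ]
      exact fun x hx h0 hG' hH' => hgpos ℓ x hx ⟨h0, hG', hH'⟩
  choose a ha hag using hcert
  choose σ0 σs σu σg τ h0 hs hu hg hτ e using ha
  refine ⟨σ0, σs, σu, fun j => σg (cl j) j, fun j => τ (iCl j) j, h0, hs, fun ℓ v _ => hu ℓ v,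
    fun j => hg _ j, fun j => hτ _ j, ?_⟩
  rw [hfg, ← Finset.sum_fiberwise (s := Finset.univ) (g := cl) (f := fun j => G j * σg (cl j) j),
    ← Finset.sum_fiberwise (s := Finset.univ) (g := iCl) (f := fun j => τ (iCl j) j * H j),
    ← Finset.sum_add_distrib, ← Finset.sum_add_distrib]
  refine Finset.sum_congr rfl fun ℓ _ => ?_
  rw [← hag ℓ, e ℓ]
  congr 1
  · congr 1
    refine Finset.sum_congr rfl fun j hj => ?_
    rw [(Finset.mem_filter.1 hj).2]
  · refine Finset.sum_congr rfl fun j hj => ?_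
    rw [(Finset.mem_filter.1 hj).2]

end Clique

theorem MvPolynomial.IsHomogeneous.eval_const_mul {σ : Type*} {P : MvPolynomial σ ℝ} {d : ℕ}
    (hP : P.IsHomogeneous d) (c : ℝ) (x : σ → ℝ) :
    eval (fun i => c * x i) P = c ^ d * eval x P := by
  rw [eval_eq, eval_eq, Finset.mul_sum]
  refine Finset.sum_congr rfl fun m hm => ?_
  simp only [mul_pow, Finset.prod_mul_distrib, Finset.prod_pow_eq_pow_sum]
  have hd : ∑ i ∈ m.support, m i = d := by
    simpa [Finsupp.weight_apply, Finsupp.sum] using hP (mem_support_iff.1 hm)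
  rw [hd]
  ring

/-- A homogeneous polynomial is positive on the part of the unit sphere cut out by homogeneous
inequalities and `0 ≤ x 0` if its dehomogenization and its part at infinity are. -/
theorem eval_pos_of_homogenization {n : ℕ} {ι : Type*} {F : MvPolynomial (Fin (n + 1)) ℝ} {d : ℕ}
    (hF : F.IsHomogeneous d) {G : ι → MvPolynomial (Fin (n + 1)) ℝ} {e : ι → ℕ}
    (hG : ∀ j, (G j).IsHomogeneous (e j))
    (hpos : ∀ x : Fin n → ℝ, (∀ j, 0 ≤ eval (Fin.cons 1 x) (G j)) → 0 < eval (Fin.cons 1 x) F)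
    (hinf : ∀ x : Fin n → ℝ, (∀ j, 0 ≤ eval (Fin.cons 0 x) (G j)) → ∑ i, x i ^ 2 = 1 →
      0 < eval (Fin.cons 0 x) F)
    {y : Fin (n + 1) → ℝ} (hy0 : 0 ≤ y 0) (hy : ∀ j, 0 ≤ eval y (G j)) (hy1 : ∑ i, y i ^ 2 = 1) :
    0 < eval y F := by
  rcases hy0.eq_or_lt with h0 | h0
  · have hyc : y = Fin.cons 0 (Fin.tail y) := by rw [h0, Fin.cons_self_tail]
    rw [hyc] at hy ⊢
    refine hinf _ hy ?_
    rw [Fin.sum_univ_succ, ← h0] at hy1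
    simpa [Fin.tail] using hy1
  · have hyc : y = fun i =>
        y 0 * (Fin.cons 1 fun j => y j.succ / y 0 : Fin (n + 1) → ℝ) i := by
      ext i
      cases i using Fin.cases with
      | zero => simp
      | succ j => simp [mul_div_cancel₀ _ h0.ne']
    rw [hyc, hF.eval_const_mul]
    refine mul_pos (pow_pos h0 _) (hpos _ fun j => ?_)
    have hj := hy j
    rw [hyc, (hG j).eval_const_mul] at hj
    exact nonneg_of_mul_nonneg_right hj (pow_pos h0 _)

/-- Suppose `K` is closed at infinity, `f > 0` on `K`, and `f` is
positive at infinity on `K`. Let `(x(1),…,x(p))` be a csp of `f`, and let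
`u(1),…,u(q)` be cliques of the lifted variables `{x₀,…,x_n,w_1,…,w_p}` covering all of
them, each containing `x₀`, satisfying the RIP, decomposing `f̃`, and supporting the
`g̃_j` (partition via `cl : Fin m → Fin q`) and the `h'_j` (partition via
`iCl : Fin (p+1) → Fin q`). Then
`f̃ = Σ_ℓ (σ_{ℓ,0} + x₀·σ_{ℓ,∗} + Σ_{u_i∈u(ℓ)} σ_{ℓ,i}·(1 − u_i²))
      + Σ_j g̃_j·σ_j + Σ_j τ_j·h'_j`
with all `σ`'s sums of squares in the appropriate `ℝ[u(ℓ)]` and `τ_j ∈ ℝ[u(iCl j)]`. -/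
theorem stmt_17
    (n m p q : ℕ) (hn : 1 ≤ n) (hm : 1 ≤ m) (hp : 1 ≤ p) (hq : 1 ≤ q)
    (f : MvPolynomial (Fin n) ℝ) (g : Fin m → MvPolynomial (Fin n) ℝ)
    (K : Set (Fin n → ℝ)) (hK : K = {x | ∀ j, 0 ≤ eval x (g j)})
    -- homogenizations
    (F : MvPolynomial (Fin (n + 1)) ℝ)
    (hFhom : F.IsHomogeneous f.totalDegree)
    (hFdeh : ∀ x : Fin n → ℝ, eval (Fin.cons 1 x) F = eval x f)
    (G : Fin m → MvPolynomial (Fin (n + 1)) ℝ)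
    (hGhom : ∀ j, (G j).IsHomogeneous (g j).totalDegree)
    (hGdeh : ∀ j, ∀ x : Fin n → ℝ, eval (Fin.cons 1 x) (G j) = eval x (g j))
    -- K is closed at infinity
    (Kt : Set (Fin (n + 1) → ℝ))
    (hKt : Kt = {y | (∀ j, 0 ≤ eval y (G j)) ∧ 0 ≤ y 0 ∧ ∑ i, (y i) ^ 2 = 1})
    (hclosed : Kt = closure (Kt ∩ {y | 0 < y 0}))
    -- f is positive on K and positive at infinity on K
    (hfpos : ∀ x ∈ K, 0 < eval x f)
    (hfinf : ∀ x : Fin n → ℝ,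
      (∀ j, 0 ≤ eval (Fin.cons 0 x) (G j)) → (∑ i, (x i) ^ 2 = 1) →
      0 < eval (Fin.cons 0 x) F)
    -- correlative sparsity pattern of f
    (I : Fin p → Finset (Fin n)) (hI : ∀ i : Fin n, ∃ ℓ : Fin p, i ∈ I ℓ)
    (fdec : Fin p → MvPolynomial (Fin n) ℝ)
    (hfdec : f = ∑ ℓ, fdec ℓ) (hfvars : ∀ ℓ, (fdec ℓ).vars ⊆ I ℓ)
    -- p_i: frequency of the variable x_i among the cliques
    (pc : Fin n → ℕ) (hpc : ∀ i, pc i = (Finset.univ.filter fun ℓ => i ∈ I ℓ).card)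
    -- the constraint polynomials h'_1,…,h'_p, h'_{p+1}
    (H : Fin (p + 1) → MvPolynomial (Fin (n + 1) ⊕ Fin p) ℝ)
    (hH : ∀ ℓ : Fin p, H ℓ.castSucc =
      (∑ i ∈ I ℓ, C ((pc i : ℝ))⁻¹ * (X (Sum.inl i.succ)) ^ 2)
        + C ((p : ℝ))⁻¹ * (X (Sum.inl 0)) ^ 2 + (X (Sum.inr ℓ)) ^ 2 - 1)
    (hHlast : H (Fin.last p) = (∑ ℓ, (X (Sum.inr ℓ)) ^ 2) - C ((p : ℝ) - 1))
    -- the cliques u(1),…,u(q) of the lifted variables, each containing x₀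
    (U : Fin q → Finset (Fin (n + 1) ⊕ Fin p))
    (hU : ∀ v : Fin (n + 1) ⊕ Fin p, ∃ ℓ : Fin q, v ∈ U ℓ)
    (hU0 : ∀ ℓ, Sum.inl 0 ∈ U ℓ)
    -- running intersection property for the u-cliques
    (hRIP : ∀ (ℓ : Fin q) (h : (ℓ : ℕ) + 1 < q), ∃ s : Fin q, s ≤ ℓ ∧
      U ⟨(ℓ : ℕ) + 1, h⟩ ∩ (Finset.Iic ℓ).biUnion U ⊆ U s)
    -- f̃ decomposes along the u-cliques
    (Fdec : Fin q → MvPolynomial (Fin (n + 1) ⊕ Fin p) ℝ)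
    (hFdec : rename Sum.inl F = ∑ ℓ, Fdec ℓ)
    (hFdecvars : ∀ ℓ, (Fdec ℓ).vars ⊆ U ℓ)
    -- the g̃_j are supported on the u-cliques (partition J_1,…,J_q)
    (cl : Fin m → Fin q)
    (hGvars : ∀ j, (rename Sum.inl (G j)).vars ⊆ U (cl j))
    -- the constraints h'_j are supported on the u-cliques (partition I_1,…,I_q)
    (iCl : Fin (p + 1) → Fin q)
    (hHvars : ∀ j, (H j).vars ⊆ U (iCl j)) :
    ∃ (σ0 σs : Fin q → MvPolynomial (Fin (n + 1) ⊕ Fin p) ℝ)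
      (σu : Fin q → (Fin (n + 1) ⊕ Fin p) → MvPolynomial (Fin (n + 1) ⊕ Fin p) ℝ)
      (σg : Fin m → MvPolynomial (Fin (n + 1) ⊕ Fin p) ℝ)
      (τ : Fin (p + 1) → MvPolynomial (Fin (n + 1) ⊕ Fin p) ℝ),
      (∀ ℓ, IsSOSOn (U ℓ) (σ0 ℓ)) ∧
      (∀ ℓ, IsSOSOn (U ℓ) (σs ℓ)) ∧
      (∀ ℓ, ∀ v ∈ U ℓ, IsSOSOn (U ℓ) (σu ℓ v)) ∧
      (∀ j, IsSOSOn (U (cl j)) (σg j)) ∧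
      (∀ j, (τ j).vars ⊆ U (iCl j)) ∧
      rename Sum.inl F
        = (∑ ℓ, (σ0 ℓ + X (Sum.inl 0) * σs ℓ
            + ∑ v ∈ U ℓ, σu ℓ v * (1 - (X v) ^ 2)))
          + (∑ j, rename Sum.inl (G j) * σg j)
          + ∑ j, τ j * H j := by
  rw [hFdec]
  refine exists_sparse_certificate hq hU0 hRIP cl hGvars iCl hHvars Fdec hFdecvars
    fun x hx0 hxG hxH => ?_
  rw [← hFdec, eval_rename]
  simp only [eval_rename] at hxG
  refine eval_pos_of_homogenization hFhom hGhom (fun z hz => ?_) hfinf hx0 hxG ?_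
  · rw [hFdeh]
    refine hfpos z ?_
    rw [hK]
    exact fun j => hGdeh j z ▸ hz j
  · have hcast : ∀ ℓ : Fin p, ∑ i ∈ I ℓ, (pc i : ℝ)⁻¹ * x (Sum.inl i.succ) ^ 2
        + (p : ℝ)⁻¹ * x (Sum.inl 0) ^ 2 + x (Sum.inr ℓ) ^ 2 - 1 = 0 := by
      intro ℓ
      simpa [hH] using hxH ℓ.castSucc
    have hlast : ∑ ℓ, x (Sum.inr ℓ) ^ 2 - ((p : ℝ) - 1) = 0 := by
      simpa [hHlast] using hxH (Fin.last p)
    have hsum := Finset.sum_eq_zero fun ℓ (_ : ℓ ∈ Finset.univ) => hcast ℓ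
    have hp0 : (p : ℝ) ≠ 0 := by positivity
    have hswap : ∑ ℓ, ∑ i ∈ I ℓ, (pc i : ℝ)⁻¹ * x (Sum.inl i.succ) ^ 2
        = ∑ i : Fin n, x (Sum.inl i.succ) ^ 2 := by
      rw [Finset.sum_comm' (t' := Finset.univ) (s' := fun i => {ℓ | i ∈ I ℓ}) (by simp)]
      refine Finset.sum_congr rfl fun i _ => ?_
      obtain ⟨ℓ, hℓ⟩ := hI i
      have hne : (pc i : ℝ) ≠ 0 := by
        rw [hpc, Nat.cast_ne_zero]
        exact Finset.card_ne_zero_of_mem (Finset.mem_filter.2 ⟨Finset.mem_univ ℓ, hℓ⟩)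
      rw [Finset.sum_const, ← hpc, nsmul_eq_mul, mul_inv_cancel_left₀ hne]
    rw [Finset.sum_sub_distrib, Finset.sum_add_distrib, Finset.sum_add_distrib, hswap] at hsum
    simp only [Finset.sum_const, Finset.card_univ, Fintype.card_fin, nsmul_eq_mul, mul_one,
      mul_inv_cancel_left₀ hp0] at hsum
    rw [Fin.sum_univ_succ]
    simp only [Function.comp_apply]
    linarith
end

section
/- Let x* ∈ K. Set t := √(1 + ‖x*‖²), x̃* := (1, x*)/t ∈ ℝ^{n+1}, and for each ℓ = 1,…,p set w*_ℓ := √(1 − Σ_{x_i ∈ x(ℓ)} (x̃*_i)²/p_i − (x̃*_0)²/p). Then for every ℓ one has Σ_{x_i ∈ x(ℓ)} (x̃*_i)²/p_i + (x̃*_0)²/p ≤ 1 (so each w*_ℓ is well defined), (w*_1)² + ⋯ + (w*_p)² = p − 1, and (x̃*, w*) ∈ K̃_s². -/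
open MvPolynomial

/-- Evaluating a homogeneous polynomial at a scaled point pulls out the power of the scalar. -/
lemma MvPolynomial.IsHomogeneous.eval_mul_left {σ R : Type*} [CommSemiring R]
    {φ : MvPolynomial σ R} {d : ℕ} (hφ : φ.IsHomogeneous d) (c : R) (x : σ → R) :
    eval (fun i => c * x i) φ = c ^ d * eval x φ := by
  rw [eval_eq, eval_eq, Finset.mul_sum]
  refine Finset.sum_congr rfl fun s hs => ?_
  have hdeg : ∑ i ∈ s.support, s i = d := by
    rw [← hφ (mem_support_iff.mp hs), Finsupp.weight_apply]
    simp [Finsupp.sum]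
  simp only [mul_pow, Finset.prod_mul_distrib, Finset.prod_pow_eq_pow_sum, hdeg]
  ring

/-- Summing `a i / c i` over all members of a cover, where `c i` is the number of members
containing `i`, gives back the sum of `a`. -/
lemma sum_sum_div_card_filter_mem {ι κ 𝕜 : Type*} [Fintype ι] [Fintype κ] [DecidableEq ι]
    [Field 𝕜] [CharZero 𝕜] (I : κ → Finset ι) (hI : ∀ i, ∃ k, i ∈ I k) (a : ι → 𝕜) :
    ∑ k, ∑ i ∈ I k, a i / ((Finset.univ.filter fun k => i ∈ I k).card : 𝕜) = ∑ i, a i := by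
  rw [Finset.sum_comm' (t' := Finset.univ) (s' := fun i => Finset.univ.filter fun k => i ∈ I k)
    (by simp)]
  refine Finset.sum_congr rfl fun i _ => ?_
  obtain ⟨k, hk⟩ := hI i
  have hne : ((Finset.univ.filter fun k => i ∈ I k).card : 𝕜) ≠ 0 :=
    Nat.cast_ne_zero.mpr
      (Finset.card_ne_zero_of_mem (Finset.mem_filter.mpr ⟨Finset.mem_univ k, hk⟩))
  rw [Finset.sum_const, nsmul_eq_mul, mul_div_cancel₀ _ hne]


/-- Let `x* ∈ K`. Set `t := √(1 + ‖x*‖²)`, `x̃* := (1, x*)/t`, and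
`w*_ℓ := √(1 − Σ_{x_i∈x(ℓ)} (x̃*_i)²/p_i − (x̃*_0)²/p)`. Then for every `ℓ` one has
`Σ_{x_i∈x(ℓ)} (x̃*_i)²/p_i + (x̃*_0)²/p ≤ 1` (so each `w*_ℓ` is well defined),
`(w*_1)² + ⋯ + (w*_p)² = p − 1`, and `(x̃*, w*) ∈ K̃ₛ²`. -/
theorem stmt_19
    (n m p : ℕ) (hn : 1 ≤ n) (hm : 1 ≤ m) (hp : 1 ≤ p)
    (g : Fin m → MvPolynomial (Fin n) ℝ)
    (I : Fin p → Finset (Fin n)) (hI : ∀ i : Fin n, ∃ ℓ : Fin p, i ∈ I ℓ)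
    -- p_i: frequency of the variable x_i among the cliques
    (pc : Fin n → ℕ) (hpc : ∀ i, pc i = (Finset.univ.filter fun ℓ => i ∈ I ℓ).card)
    (K : Set (Fin n → ℝ)) (hK : K = {x | ∀ j, 0 ≤ eval x (g j)})
    -- homogenizations
    (G : Fin m → MvPolynomial (Fin (n + 1)) ℝ)
    (hGhom : ∀ j, (G j).IsHomogeneous (g j).totalDegree)
    (hGdeh : ∀ j, ∀ x : Fin n → ℝ, eval (Fin.cons 1 x) (G j) = eval x (g j))
    -- the sparse homogenized set K̃ₛ²
    (Ks : Set ((Fin (n + 1) → ℝ) × (Fin p → ℝ)))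
    (hKs : Ks = {z | 0 ≤ z.1 0 ∧ (∀ j, 0 ≤ eval z.1 (G j)) ∧
      (∀ ℓ : Fin p, (∑ i ∈ I ℓ, (z.1 i.succ) ^ 2 / (pc i : ℝ))
        + (z.1 0) ^ 2 / (p : ℝ) + (z.2 ℓ) ^ 2 = 1) ∧
      (∑ ℓ, (z.2 ℓ) ^ 2 = (p : ℝ) - 1) ∧
      (∀ i : Fin (n + 1), 0 ≤ 1 - (z.1 i) ^ 2) ∧
      (∀ ℓ : Fin p, 0 ≤ 1 - (z.2 ℓ) ^ 2)})
    -- the point x* and its lift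
    (xstar : Fin n → ℝ) (hxK : xstar ∈ K)
    (t : ℝ) (ht : t = Real.sqrt (1 + ∑ i, (xstar i) ^ 2))
    (xt : Fin (n + 1) → ℝ)
    (hxt : xt = fun i => (Fin.cons (1 : ℝ) xstar : Fin (n + 1) → ℝ) i / t)
    (wt : Fin p → ℝ)
    (hwt : wt = fun ℓ => Real.sqrt (1 - (∑ i ∈ I ℓ, (xt i.succ) ^ 2 / (pc i : ℝ))
      - (xt 0) ^ 2 / (p : ℝ))) :
    (∀ ℓ : Fin p,
      (∑ i ∈ I ℓ, (xt i.succ) ^ 2 / (pc i : ℝ)) + (xt 0) ^ 2 / (p : ℝ) ≤ 1) ∧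
    (∑ ℓ, (wt ℓ) ^ 2 = (p : ℝ) - 1) ∧
    (xt, wt) ∈ Ks := by
  have htsq : t ^ 2 = 1 + ∑ i, (xstar i) ^ 2 := by rw [ht, Real.sq_sqrt (by positivity)]
  have htpos : 0 < t := by rw [ht]; positivity
  have hp1 : (1 : ℝ) ≤ p := by exact_mod_cast hp
  have hxt0 : xt 0 = 1 / t := by simp [hxt]
  have hxts : ∀ i : Fin n, xt i.succ = xstar i / t := fun i => by simp [hxt]
  have hunit : (∑ i : Fin n, (xt i.succ) ^ 2) + (xt 0) ^ 2 = 1 := by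
    simp only [hxt0, hxts, div_pow, ← Finset.sum_div]
    rw [← add_div, htsq, one_pow, add_comm, div_self (by positivity)]
  have hle : ∀ ℓ : Fin p,
      (∑ i ∈ I ℓ, (xt i.succ) ^ 2 / (pc i : ℝ)) + (xt 0) ^ 2 / (p : ℝ) ≤ 1 := by
    intro ℓ
    rw [← hunit]
    refine add_le_add ?_ (div_le_self (sq_nonneg _) hp1)
    calc ∑ i ∈ I ℓ, (xt i.succ) ^ 2 / (pc i : ℝ)
        ≤ ∑ i ∈ I ℓ, (xt i.succ) ^ 2 := by
          refine Finset.sum_le_sum fun i hi => div_le_self (sq_nonneg _) ?_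
          rw [hpc i]
          exact_mod_cast Finset.card_pos.mpr
            ⟨ℓ, Finset.mem_filter.mpr ⟨Finset.mem_univ ℓ, hi⟩⟩
      _ ≤ ∑ i : Fin n, (xt i.succ) ^ 2 :=
          Finset.sum_le_univ_sum_of_nonneg fun i => sq_nonneg _
  have hwsq : ∀ ℓ, (wt ℓ) ^ 2 =
      1 - ((∑ i ∈ I ℓ, (xt i.succ) ^ 2 / (pc i : ℝ)) + (xt 0) ^ 2 / (p : ℝ)) := by
    intro ℓ
    rw [hwt, ← sub_sub]
    exact Real.sq_sqrt (by linarith [hle ℓ])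
  have hwsum : ∑ ℓ, (wt ℓ) ^ 2 = (p : ℝ) - 1 := by
    have hcover : ∑ ℓ, ∑ i ∈ I ℓ, (xt i.succ) ^ 2 / (pc i : ℝ) = ∑ i : Fin n, (xt i.succ) ^ 2 := by
      simp only [hpc]
      exact sum_sum_div_card_filter_mem I hI _
    simp only [hwsq, Finset.sum_sub_distrib, Finset.sum_add_distrib, hcover, Finset.sum_const,
      Finset.card_univ, Fintype.card_fin, nsmul_eq_mul, mul_one]
    rw [mul_div_cancel₀ _ (by positivity), hunit]
  refine ⟨hle, hwsum, ?_⟩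
  rw [hKs]
  refine ⟨?_, fun j => ?_, fun ℓ => ?_, hwsum, fun i => ?_, fun ℓ => ?_⟩
  · show 0 ≤ xt 0
    rw [hxt0]
    positivity
  · have hscale : xt = fun i => t⁻¹ * (Fin.cons (1 : ℝ) xstar : Fin (n + 1) → ℝ) i := by
      simp only [hxt, div_eq_inv_mul]
    rw [hK] at hxK
    show 0 ≤ eval xt (G j)
    rw [hscale, (hGhom j).eval_mul_left, hGdeh]
    exact mul_nonneg (by positivity) (hxK j)
  · show _ + _ + (wt ℓ) ^ 2 = 1
    rw [hwsq]
    ring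
  · have hsum : ∑ i, (xt i) ^ 2 = 1 := by rw [Fin.sum_univ_succ, add_comm, hunit]
    show 0 ≤ 1 - (xt i) ^ 2
    rw [sub_nonneg, ← hsum]
    exact Finset.single_le_sum (f := fun i => (xt i) ^ 2) (fun i _ => sq_nonneg _)
      (Finset.mem_univ i)
  · show 0 ≤ 1 - (wt ℓ) ^ 2
    rw [hwsq, sub_sub_cancel]
    positivity
end
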